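/- Assume additionally that yⁿ = I. Let γ ∈ ℂ, set H = x + γ y, and let λ ≠ 0 be an eigenvalue of x with λⁿ + γⁿ = 0. Then the algebraic multiplicity of 0 as an eigenvalue of H satisfies μ_a(0, H) ≥ n · μ_g(λ, x). -/

import Mathlib

open Matrix

/-- The geometric multiplicity of `μ` as an eigenvalue of `A`:
the dimension of `ker (μ • 1 − A)`. -/
noncomputable def geomMult {N : ℕ} (A : Matrix (Fin N) (Fin N) ℂ) (μ : ℂ) : ℕ :=
  Module.finrank ℂ (LinearMap.ker (μ • (1 : Matrix (Fin N) (Fin N) ℂ) - A).mulVecLin)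

/-- The algebraic multiplicity of `μ` as an eigenvalue of `A`:
the multiplicity of `μ` as a root of the characteristic polynomial of `A`. -/
noncomputable def algMult {N : ℕ} (A : Matrix (Fin N) (Fin N) ℂ) (μ : ℂ) : ℕ :=
  (Matrix.charpoly A).rootMultiplicity μ

theorem aux_semiconj {A : Type*} [Ring A] [Algebra ℂ A] (y z w : A) (h : z * y = y * w)
    (p : Polynomial ℂ) : Polynomial.aeval z p * y = y * Polynomial.aeval w p := by
  induction p using Polynomial.induction_on' with
  | add p r hp hr => simp [add_mul, mul_add, hp, hr]
  | monomial k a =>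
    have hk : z ^ k * y = y * w ^ k := by
      induction k with
      | zero => simp
      | succ k ih => rw [pow_succ, mul_assoc, h, ← mul_assoc, ih, mul_assoc, ← pow_succ]
    rw [Polynomial.aeval_monomial, Polynomial.aeval_monomial, mul_assoc, hk, ← mul_assoc,
      Algebra.commutes, mul_assoc, Algebra.commutes]

theorem aux_pow {A : Type*} [Ring A] [Algebra ℂ A] (y z : A) (q γ : ℂ)
    (h : z * y = q • (y * z)) (k : ℕ) :
    (y * z + γ • y) ^ k = y ^ k * Polynomial.aeval z
      (∏ j ∈ Finset.range k, (Polynomial.C γ + Polynomial.C (q ^ j) * Polynomial.X)) := by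
  induction k with
  | zero => simp
  | succ k ih =>
    rw [pow_succ, ih, Finset.prod_range_succ']
    have h1 : y * z + γ • y = y * Polynomial.aeval z (Polynomial.C γ + Polynomial.X) := by
      simp [mul_add, Algebra.smul_def, Algebra.commutes, add_comm]
    have h2 := aux_semiconj y z (q • z) (by rw [h]; simp)
      (∏ j ∈ Finset.range k, (Polynomial.C γ + Polynomial.C (q ^ j) * Polynomial.X))
    have h3 : Polynomial.aeval (q • z)
      (∏ j ∈ Finset.range k, (Polynomial.C γ + Polynomial.C (q ^ j) * Polynomial.X))
      = Polynomial.aeval z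
      (∏ j ∈ Finset.range k, (Polynomial.C γ + Polynomial.C (q ^ (j+1)) * Polynomial.X)) := by
      have : q • z = Polynomial.aeval z (Polynomial.C q * Polynomial.X) := by
        simp [Algebra.smul_def]
      rw [this, ← Polynomial.aeval_comp, Polynomial.prod_comp]
      congr 1
      refine Finset.prod_congr rfl fun j _ => ?_
      simp [pow_succ, mul_assoc]
    rw [h1, mul_assoc, ← mul_assoc _ y, h2, h3, map_mul, pow_succ]
    simp [mul_assoc]

theorem aux_prod {n : ℕ} (hn : 0 < n) {q : ℂ} (hq : IsPrimitiveRoot q n) (γ : ℂ) :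
    ∏ j ∈ Finset.range n, (Polynomial.C γ + Polynomial.C (q ^ j) * Polynomial.X)
      = Polynomial.C γ ^ n - (-Polynomial.X) ^ n := by
  have hq' : IsPrimitiveRoot (Polynomial.C q) n := hq.map_of_injective Polynomial.C_injective
  rw [hq'.pow_sub_pow_eq_prod_sub_mul _ _ hn]
  symm
  have : NeZero n := ⟨hn.ne'⟩
  refine (Finset.prod_bij (fun j _ => Polynomial.C q ^ j) ?_ ?_ ?_ ?_).symm
  · intro j _
    rw [Polynomial.mem_nthRootsFinset hn, ← pow_mul, mul_comm, pow_mul, hq'.pow_eq_one, one_pow]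
  · intro i hi j hj hij
    exact hq'.pow_inj (Finset.mem_range.1 hi) (Finset.mem_range.1 hj) hij
  · intro b hb
    rw [Polynomial.mem_nthRootsFinset hn] at hb
    obtain ⟨i, hi, h⟩ := hq'.eq_pow_of_pow_eq_one hb
    exact ⟨i, Finset.mem_range.2 hi, h⟩
  · intro j _
    simp

theorem aux_binom {A : Type*} [Ring A] [Algebra ℂ A] {n : ℕ} (hn : 0 < n) {q : ℂ}
    (hq : IsPrimitiveRoot q n) (x y : A) (hxy : x * y = q • (y * x)) (hyn : y ^ n = 1) (γ : ℂ) :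
    (x + γ • y) ^ n = x ^ n + algebraMap ℂ A (γ ^ n) := by
  obtain ⟨m, rfl⟩ : ∃ m, n = m + 1 := ⟨n - 1, by omega⟩
  have hx : y * (y ^ m * x) = x := by rw [← mul_assoc, ← pow_succ', hyn, one_mul]
  have hz : (y ^ m * x) * y = q • (y * (y ^ m * x)) := by
    rw [hx, mul_assoc, hxy, mul_smul_comm, ← mul_assoc, ← pow_succ, hyn, one_mul]
  have key := fun g => aux_pow y (y ^ m * x) q g hz (m + 1)
  simp only [hx, aux_prod hn hq, hyn, one_mul] at key
  have h0 := key 0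
  rw [key γ]
  simp at h0 ⊢
  rw [h0]; abel

/-- Let `q` be a primitive n-th root of unity, `x y = q y x`, `yⁿ = 1`, `γ ∈ ℂ` and
`H = x + γ y`.  If `λ ≠ 0` is an eigenvalue of `x` with `λⁿ + γⁿ = 0`, then
`μ_a(0, H) ≥ n · μ_g(λ, x)`. -/
theorem stmt6 {N n : ℕ} (hN : 0 < N) (hn : 0 < n) {q : ℂ} (hq : IsPrimitiveRoot q n)
    (x y : Matrix (Fin N) (Fin N) ℂ) (hxy : x * y = q • (y * x)) (hyn : y ^ n = 1)
    (γ : ℂ) (lam : ℂ) (hlam0 : lam ≠ 0) (hlam : lam ∈ spectrum ℂ x)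
    (hcrit : lam ^ n + γ ^ n = 0) :
    n * geomMult x lam ≤ algMult (x + γ • y) 0 := by
  unfold geomMult algMult
  rw [← Matrix.charpoly_mulVecLin, ← LinearMap.finrank_maxGenEigenspace_eq]
  set E := LinearMap.ker (lam • (1 : Matrix (Fin N) (Fin N) ℂ) - x).mulVecLin with hE
  have hEm : ∀ v ∈ E, x *ᵥ v = lam • v := by
    intro v hv
    rw [hE, LinearMap.mem_ker, Matrix.mulVecLin_apply, Matrix.sub_mulVec, Matrix.smul_mulVec,
      Matrix.one_mulVec, sub_eq_zero] at hv
    exact hv.symm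
  have hyk : ∀ k : ℕ, x * y ^ k = q ^ k • (y ^ k * x) := by
    intro k
    induction k with
    | zero => simp
    | succ k ih =>
      rw [pow_succ, ← mul_assoc, ih, smul_mul_assoc, mul_assoc, hxy, mul_smul_comm, smul_smul,
        ← mul_assoc, pow_succ q]
  have hxyk : ∀ (k : ℕ), ∀ v ∈ E, x *ᵥ (y ^ k *ᵥ v) = (q ^ k * lam) • (y ^ k *ᵥ v) := by
    intro k v hv
    rw [Matrix.mulVec_mulVec, hyk, Matrix.smul_mulVec, ← Matrix.mulVec_mulVec, hEm v hv,
      Matrix.mulVec_smul, smul_smul]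
  have hind : iSupIndep fun k : Fin n =>
      Module.End.eigenspace x.mulVecLin (q ^ (k : ℕ) * lam) :=
    (Module.End.eigenspaces_iSupIndep x.mulVecLin).comp (f := fun k : Fin n => q ^ (k:ℕ) * lam)
      (fun i j hij => Fin.ext (hq.pow_inj i.2 j.2 (mul_right_cancel₀ hlam0 hij)))
  let Φ : (Fin n → E) →ₗ[ℂ] (Fin N → ℂ) :=
    ∑ k : Fin n, (y ^ (k : ℕ)).mulVecLin ∘ₗ E.subtype ∘ₗ LinearMap.proj k
  have hΦ : ∀ f, Φ f = ∑ k : Fin n, y ^ (k : ℕ) *ᵥ (f k : Fin N → ℂ) := by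
    intro f; simp [Φ]
  have hinj : Function.Injective Φ := by
    rw [injective_iff_map_eq_zero]
    intro f hf
    rw [hΦ] at hf
    have := (iSupIndep_iff_finsetSum_eq_zero_imp_eq_zero _).1 hind Finset.univ
      (fun k => y ^ (k : ℕ) *ᵥ (f k : Fin N → ℂ))
      (fun k _ => by
        rw [Module.End.mem_eigenspace_iff]
        exact hxyk k _ (f k).2) hf
    ext1 k
    have hk := this k (Finset.mem_univ k)
    have h2 : y ^ (n - k : ℕ) *ᵥ (y ^ (k : ℕ) *ᵥ (f k : Fin N → ℂ)) = f k := by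
      rw [Matrix.mulVec_mulVec, ← pow_add, Nat.sub_add_cancel k.2.le, hyn, Matrix.one_mulVec]
    apply Subtype.ext
    rw [← h2]
    rw [hk]; simp
  have hxn : ∀ (v : Fin N → ℂ) (c : ℂ), x *ᵥ v = c • v → ∀ m : ℕ, x ^ m *ᵥ v = c ^ m • v := by
    intro v c h m
    induction m with
    | zero => simp
    | succ m ih =>
      rw [pow_succ, ← Matrix.mulVec_mulVec, h, Matrix.mulVec_smul, ih, smul_smul, pow_succ']
  have hrange : LinearMap.range Φ ≤ Module.End.maxGenEigenspace (x + γ • y).mulVecLin 0 := by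
    rintro _ ⟨f, rfl⟩
    rw [Module.End.mem_maxGenEigenspace]
    refine ⟨n, ?_⟩
    rw [zero_smul, sub_zero, hΦ, map_sum]
    refine Finset.sum_eq_zero fun k _ => ?_
    have : (x + γ • y).mulVecLin ^ n = ((x + γ • y) ^ n).mulVecLin :=
      (Matrix.toLin'_pow _ _).symm
    rw [this, aux_binom hn hq x y hxy hyn, Matrix.mulVecLin_apply, Matrix.add_mulVec,
      hxn _ _ (hxyk k _ (f k).2), Algebra.algebraMap_eq_smul_one, Matrix.smul_mulVec,
      Matrix.one_mulVec, ← add_smul, mul_pow, ← pow_mul, mul_comm (k : ℕ), pow_mul,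
      hq.pow_eq_one, one_pow, one_mul, hcrit, zero_smul]
  calc n * Module.finrank ℂ E = Module.finrank ℂ (Fin n → E) := by
        rw [Module.finrank_pi_fintype]; simp
    _ = Module.finrank ℂ (LinearMap.range Φ) := (LinearMap.finrank_range_of_inj hinj).symm
    _ ≤ _ := Submodule.finrank_mono hrange
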